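/- Let φ: ℝ^n → ℝ be C² with everywhere positive definite Hessian, satisfying the Monge–Ampère equation det(Hess φ(ρ)) = e^{−φ(ρ)} for all ρ, and suppose ∇φ is a diffeomorphism from ℝ^n onto a bounded open convex set P ⊆ ℝ^n. Then: (a) vol(P) = ∫_{ℝ^n} e^{−φ(ρ)} dρ < ∞; and (b) ∫_P x dx = 0, i.e. the center of mass of P is the origin. -/

import Mathlib

open Real MeasureTheory

/-- The Hessian matrix of `f : ℝ^n → ℝ` at `ρ`, with entries the second derivatives
in the standard coordinate directions. -/
noncomputable def hessMat (n : ℕ) (f : EuclideanSpace ℝ (Fin n) → ℝ)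
    (ρ : EuclideanSpace ℝ (Fin n)) : Matrix (Fin n) (Fin n) ℝ :=
  fun i j => iteratedFDeriv ℝ 2 f ρ ![EuclideanSpace.single i 1, EuclideanSpace.single j 1]

section HessianOfGradient

variable {n : ℕ} {f : EuclideanSpace ℝ (Fin n) → ℝ}

lemma gradient_apply_eq_fderiv_single (x : EuclideanSpace ℝ (Fin n)) (i : Fin n) :
    gradient f x i = fderiv ℝ f x (EuclideanSpace.single i 1) := by
  have h := EuclideanSpace.inner_single_right (𝕜 := ℝ) i 1 (gradient f x)
  rw [inner_gradient_left] at h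
  simpa using h.symm

lemma hasFDerivAt_gradient_apply (hf : ContDiff ℝ 2 f) (x : EuclideanSpace ℝ (Fin n))
    (i : Fin n) :
    HasFDerivAt (fun y => gradient f y i)
      ((fderiv ℝ (fderiv ℝ f) x).flip (EuclideanSpace.single i 1)) x := by
  simp only [gradient_apply_eq_fderiv_single]
  have hd : DifferentiableAt ℝ (fderiv ℝ f) x :=
    ((hf.fderiv_right (m := 1) (by norm_num)).differentiable (by norm_num)) x
  exact ((ContinuousLinearMap.apply ℝ ℝ
    (EuclideanSpace.single i (1 : ℝ))).hasFDerivAt.comp x hd.hasFDerivAt)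

lemma differentiable_gradient (hf : ContDiff ℝ 2 f) : Differentiable ℝ (gradient f) :=
  differentiable_euclidean.2 fun i x => (hasFDerivAt_gradient_apply hf x i).differentiableAt

lemma fderiv_gradient_single_apply (hf : ContDiff ℝ 2 f) (x : EuclideanSpace ℝ (Fin n))
    (i j : Fin n) :
    fderiv ℝ (gradient f) x (EuclideanSpace.single j 1) i = hessMat n f x j i := by
  have h := ((EuclideanSpace.proj (𝕜 := ℝ) i).hasFDerivAt.comp x
    (differentiable_gradient hf x).hasFDerivAt).unique (hasFDerivAt_gradient_apply hf x i)
  have h' := congrArg (fun L => L (EuclideanSpace.single j (1 : ℝ))) h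
  simpa [hessMat, iteratedFDeriv_two_apply] using h'

lemma det_fderiv_gradient (hf : ContDiff ℝ 2 f) (x : EuclideanSpace ℝ (Fin n)) :
    (fderiv ℝ (gradient f) x).det = (hessMat n f x).det := by
  rw [ContinuousLinearMap.det,
    ← LinearMap.det_toMatrix (EuclideanSpace.basisFun (Fin n) ℝ).toBasis,
    ← Matrix.det_transpose (hessMat n f x)]
  congr 1
  ext i j
  simp [LinearMap.toMatrix_apply, fderiv_gradient_single_apply hf]

end HessianOfGradient

lemma integral_fderiv_apply_eq_zero {E : Type*} [NormedAddCommGroup E] [NormedSpace ℝ E]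
    [FiniteDimensional ℝ E] [MeasurableSpace E] [BorelSpace E] {μ : Measure E}
    [μ.IsAddHaarMeasure] {g : E → ℝ} (hg : Differentiable ℝ g) (hgi : Integrable g μ) {v : E}
    (hgi' : Integrable (fun x => fderiv ℝ g x v) μ) :
    ∫ x, fderiv ℝ g x v ∂μ = 0 := by
  simpa using integral_mul_fderiv_eq_neg_fderiv_mul_of_integrable (μ := μ) (𝕜 := ℝ)
    (f := fun _ => 1) (g := g) (v := v) (by simp) (by simpa using hgi') (by simpa using hgi)
    (fun _ _ => differentiableAt_const _) (fun x _ => hg x)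

/-- In the Mabuchi (Kähler–Einstein) gauge `det Hess φ = e^{−φ}`, with `∇φ` a diffeomorphism
onto the bounded open convex moment polytope interior `P`: the volume of `P` equals
`∫ e^{−φ} dρ` and is finite, and the center of mass of `P` is the origin. -/
theorem kahler_einstein_center_of_mass_zero (n : ℕ)
    (φ : EuclideanSpace ℝ (Fin n) → ℝ) (hC2 : ContDiff ℝ 2 φ)
    (hpos : ∀ ρ, (hessMat n φ ρ).PosDef)
    (hMA : ∀ ρ, (hessMat n φ ρ).det = Real.exp (-φ ρ))
    (P : Set (EuclideanSpace ℝ (Fin n))) (hPo : IsOpen P) (hPb : Bornology.IsBounded P)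
    (hPc : Convex ℝ P) (hbij : Set.BijOn (gradient φ) Set.univ P) :
    (∫⁻ ρ, ENNReal.ofReal (Real.exp (-φ ρ)) = volume P ∧ volume P < ⊤) ∧
    ∫ x in P, x = (0 : EuclideanSpace ℝ (Fin n)) := by
  have hdet (x) : |(fderiv ℝ (gradient φ) x).det| = Real.exp (-φ x) := by
    rw [det_fderiv_gradient hC2, hMA, abs_of_pos (Real.exp_pos _)]
  have hder : ∀ x ∈ Set.univ,
      HasFDerivWithinAt (gradient φ) (fderiv ℝ (gradient φ) x) Set.univ x :=
    fun x _ => (differentiable_gradient hC2 x).hasFDerivAt.hasFDerivWithinAt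
  have hvol : ∫⁻ ρ, ENNReal.ofReal (Real.exp (-φ ρ)) = volume P := by
    have h := lintegral_abs_det_fderiv_eq_addHaar_image volume MeasurableSet.univ hder
      hbij.injOn
    simpa only [hdet, Measure.restrict_univ, hbij.image_eq] using h
  refine ⟨⟨hvol, hPb.measure_lt_top⟩, ?_⟩
  have hφ : Differentiable ℝ φ := hC2.differentiable (by norm_num)
  have hgrad : Continuous (gradient φ) := (differentiable_gradient hC2).continuous
  have hexp : Integrable fun ρ => Real.exp (-φ ρ) := by
    refine ⟨(Real.continuous_exp.comp hC2.continuous.neg).aestronglyMeasurable, ?_⟩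
    rw [hasFiniteIntegral_iff_ofReal (Filter.Eventually.of_forall fun _ => (Real.exp_pos _).le),
      hvol]
    exact hPb.measure_lt_top
  obtain ⟨C, hC⟩ := hPb.exists_norm_le
  have hint : Integrable fun ρ => Real.exp (-φ ρ) • gradient φ ρ :=
    hexp.smul_bdd C hgrad.aestronglyMeasurable
      (Filter.Eventually.of_forall fun ρ => hC _ (hbij.mapsTo (Set.mem_univ ρ)))
  have hcov : ∫ x in P, x = ∫ ρ, Real.exp (-φ ρ) • gradient φ ρ := by
    have h := integral_image_eq_integral_abs_det_fderiv_smul volume MeasurableSet.univ hder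
      hbij.injOn (fun x => x)
    simpa only [hdet, Measure.restrict_univ, hbij.image_eq] using h
  rw [hcov]
  refine ext_inner_left ℝ fun v => ?_
  have hfd (ρ) : fderiv ℝ (fun ρ => Real.exp (-φ ρ)) ρ v =
      -inner ℝ v (Real.exp (-φ ρ) • gradient φ ρ) := by
    rw [(hφ ρ).hasFDerivAt.fun_neg.exp.fderiv]
    simp [inner_smul_right]
  have hzero := integral_fderiv_apply_eq_zero (μ := volume) (v := v) hφ.fun_neg.exp hexp
    (by simpa only [hfd] using (hint.const_inner v).fun_neg)
  simp only [hfd] at hzero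
  rw [integral_neg, neg_eq_zero, integral_inner hint v] at hzero
  rw [hzero, inner_zero_right]
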